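/- (Revealed Preference.) Let X be a finite set of alternatives and let π be an AOM. Then for any distinct a, b ∈ X, b is revealed to be preferred to a (i.e., b ≻ a for every pair (≻, μ) with μ satisfying attention overload that represents π) if and only if b P^AC a (i.e., b ≻ a for every preference ordering ≻ such that (π, ≻) satisfies AC). -/

import Mathlib

open scoped Classical
open Finset

/-- A choice rule: probabilities are nonnegative on the choice problem, zero off it,
and sum to one over each nonempty choice problem. -/
def IsChoiceRule {α : Type*} [Fintype α] [DecidableEq α]
    (π : α → Finset α → ℝ) : Prop :=
  ∀ S : Finset α, S.Nonempty →
    (∀ a ∈ S, 0 ≤ π a S) ∧ (∀ a : α, a ∉ S → π a S = 0) ∧ (∑ a ∈ S, π a S = 1)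

/-- An attention rule: weights are nonnegative on nonempty subsets of the choice problem,
zero elsewhere, and sum to one over the nonempty subsets. -/
def IsAttentionRule {α : Type*} [Fintype α] [DecidableEq α]
    (μ : Finset α → Finset α → ℝ) : Prop :=
  ∀ S : Finset α, S.Nonempty →
    (∀ T : Finset α, T.Nonempty → T ⊆ S → 0 ≤ μ T S) ∧
    (∀ T : Finset α, ¬(T.Nonempty ∧ T ⊆ S) → μ T S = 0) ∧
    (∑ T ∈ S.powerset.filter (fun T => T.Nonempty), μ T S = 1)

/-- Attention frequency of alternative `a` in choice problem `S` under attention rule `μ`. -/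
noncomputable def attFreq {α : Type*} [Fintype α] [DecidableEq α]
    (μ : Finset α → Finset α → ℝ) (a : α) (S : Finset α) : ℝ :=
  ∑ T ∈ S.powerset.filter (fun T => a ∈ T), μ T S

/-- Attention overload: attention frequency weakly decreases as the choice problem expands. -/
def AttentionOverload {α : Type*} [Fintype α] [DecidableEq α]
    (μ : Finset α → Finset α → ℝ) : Prop :=
  ∀ (a : α) (T S : Finset α), a ∈ T → T ⊆ S → attFreq μ a S ≤ attFreq μ a T

/-- `a` is the `r`-maximum of `T`. -/
def IsMaxOf {α : Type*} (r : α → α → Prop) (a : α) (T : Finset α) : Prop :=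
  a ∈ T ∧ ∀ b ∈ T, b ≠ a → r a b

/-- The choice rule `π` is represented by the preference `r` and the attention rule `μ`. -/
noncomputable def Represents {α : Type*} [Fintype α] [DecidableEq α]
    (r : α → α → Prop) (μ : Finset α → Finset α → ℝ) (π : α → Finset α → ℝ) : Prop :=
  IsAttentionRule μ ∧
  ∀ S : Finset α, S.Nonempty → ∀ a ∈ S,
    π a S = ∑ T ∈ S.powerset, (if IsMaxOf r a T then μ T S else 0)

/-- `π` is an Attention Overload Model. -/
noncomputable def IsAOM {α : Type*} [Fintype α] [DecidableEq α]
    (π : α → Finset α → ℝ) : Prop :=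
  ∃ (r : α → α → Prop) (μ : Finset α → Finset α → ℝ),
    IsStrictTotalOrder α r ∧ AttentionOverload μ ∧ Represents r μ π

/-- `π(U_⪰(a) | T)`: probability of choosing from the weak upper contour set of `a` in `T`. -/
noncomputable def piUpper {α : Type*} [Fintype α] [DecidableEq α]
    (π : α → Finset α → ℝ) (r : α → α → Prop) (a : α) (T : Finset α) : ℝ :=
  ∑ b ∈ T.filter (fun b => r b a ∨ b = a), π b T

/-- Attention Compensation (AC). -/
noncomputable def SatisfiesAC {α : Type*} [Fintype α] [DecidableEq α]
    (π : α → Finset α → ℝ) (r : α → α → Prop) : Prop :=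
  ∀ (a : α) (T S : Finset α), a ∈ T → T ⊆ S → π a S ≤ piUpper π r a T

theorem exists_isMaxOf {α : Type*} [Finite α] {r : α → α → Prop}
    (hr : IsStrictTotalOrder α r) {T : Finset α} (hT : T.Nonempty) : ∃ b, IsMaxOf r b T := by
  obtain ⟨m, hm, hmin⟩ := (Finite.wellFounded_of_trans_of_irrefl r).has_min (T : Set α) hT
  refine ⟨m, hm, fun b hb hne => ?_⟩
  rcases trichotomous_of r m b with h | h | h
  · exact h
  · exact absurd h.symm hne
  · exact absurd h (hmin b hb)

theorem IsMaxOf.unique {α : Type*} {r : α → α → Prop} (hr : IsStrictTotalOrder α r)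
    {T : Finset α} {a b : α} (ha : IsMaxOf r a T) (hb : IsMaxOf r b T) : a = b := by
  by_contra hne
  exact asymm_of r (ha.2 b hb.1 (Ne.symm hne)) (hb.2 a ha.1 hne)

theorem IsAttentionRule.nonneg {α : Type*} [Fintype α] [DecidableEq α]
    {μ : Finset α → Finset α → ℝ} (hμ : IsAttentionRule μ) {S : Finset α} (hS : S.Nonempty)
    (T : Finset α) : 0 ≤ μ T S := by
  by_cases h : T.Nonempty ∧ T ⊆ S
  · exact (hμ S hS).1 T h.1 h.2
  · exact ((hμ S hS).2.1 T h).ge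

theorem Represents.le_attFreq {α : Type*} [Fintype α] [DecidableEq α]
    {r : α → α → Prop} {μ : Finset α → Finset α → ℝ} {π : α → Finset α → ℝ}
    (h : Represents r μ π) {a : α} {S : Finset α} (ha : a ∈ S) : π a S ≤ attFreq μ a S := by
  rw [h.2 S ⟨a, ha⟩ a ha, attFreq, Finset.sum_filter]
  refine Finset.sum_le_sum fun T _ => ?_
  by_cases hm : IsMaxOf r a T
  · simp [hm, hm.1]
  · rw [if_neg hm]
    split_ifs
    exacts [h.1.nonneg ⟨a, ha⟩ T, le_rfl]

theorem Represents.attFreq_le_piUpper {α : Type*} [Fintype α] [DecidableEq α]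
    {r : α → α → Prop} {μ : Finset α → Finset α → ℝ} {π : α → Finset α → ℝ}
    (hr : IsStrictTotalOrder α r) (h : Represents r μ π) {a : α} {S : Finset α} (ha : a ∈ S) :
    attFreq μ a S ≤ piUpper π r a S := by
  have hnn := h.1.nonneg ⟨a, ha⟩
  have hpi : piUpper π r a S = ∑ b ∈ S.filter (fun b => r b a ∨ b = a),
      ∑ T ∈ S.powerset, (if IsMaxOf r b T then μ T S else 0) :=
    Finset.sum_congr rfl fun b hb => h.2 S ⟨a, ha⟩ b (Finset.mem_filter.1 hb).1
  rw [hpi, Finset.sum_comm, attFreq, Finset.sum_filter]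
  refine Finset.sum_le_sum fun T hT => ?_
  have hterm : ∀ b ∈ S.filter (fun b => r b a ∨ b = a),
      0 ≤ (if IsMaxOf r b T then μ T S else 0) := fun b _ => by
    split_ifs
    exacts [hnn T, le_rfl]
  split_ifs with haT
  · obtain ⟨b, hb⟩ := exists_isMaxOf hr ⟨a, haT⟩
    have hmem : b ∈ S.filter (fun b => r b a ∨ b = a) := by
      refine Finset.mem_filter.2 ⟨Finset.mem_powerset.1 hT hb.1, ?_⟩
      by_cases hab : b = a
      · exact Or.inr hab
      · exact Or.inl (hb.2 a haT (Ne.symm hab))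
    have := Finset.single_le_sum hterm hmem
    rwa [if_pos hb] at this
  · exact Finset.sum_nonneg hterm

theorem Represents.satisfiesAC {α : Type*} [Fintype α] [DecidableEq α]
    {r : α → α → Prop} {μ : Finset α → Finset α → ℝ} {π : α → Finset α → ℝ}
    (hr : IsStrictTotalOrder α r) (h : Represents r μ π) (hμ : AttentionOverload μ) :
    SatisfiesAC π r := fun a T S haT hTS =>
  (h.le_attFreq (hTS haT)).trans ((hμ a T S haT hTS).trans (h.attFreq_le_piUpper hr haT))

/-- The probability of drawing `A` when each `x` is drawn independently with probability `p x`. -/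
noncomputable def bernoulliWeight {α : Type*} [Fintype α] [DecidableEq α]
    (p : α → ℝ) (A : Finset α) : ℝ :=
  (∏ x ∈ A, p x) * ∏ x ∈ univ \ A, (1 - p x)

theorem bernoulliWeight_nonneg {α : Type*} [Fintype α] [DecidableEq α]
    {p : α → ℝ} (h0 : ∀ x, 0 ≤ p x) (h1 : ∀ x, p x ≤ 1) (A : Finset α) :
    0 ≤ bernoulliWeight p A :=
  mul_nonneg (Finset.prod_nonneg fun x _ => h0 x)
    (Finset.prod_nonneg fun x _ => sub_nonneg.2 (h1 x))

theorem sum_bernoulliWeight {α : Type*} [Fintype α] [DecidableEq α] (p : α → ℝ) :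
    ∑ A : Finset α, bernoulliWeight p A = 1 := by
  have h := Finset.prod_add p (fun x => 1 - p x) (univ : Finset α)
  simp only [add_sub_cancel, Finset.prod_const_one, Finset.powerset_univ] at h
  exact h.symm

theorem sum_bernoulliWeight_mem {α : Type*} [Fintype α] [DecidableEq α] (p : α → ℝ) (a : α) :
    ∑ A : Finset α, (if a ∈ A then bernoulliWeight p A else 0) = p a := by
  have h := Finset.prod_add p (fun x => if x = a then 0 else 1 - p x) (univ : Finset α)
  rw [Finset.powerset_univ, Finset.prod_eq_single a
    (fun x _ hx => by simp [hx]) (by simp)] at h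
  simp only [if_true, add_zero] at h
  rw [h]
  refine Finset.sum_congr rfl fun A _ => ?_
  split_ifs with ha
  · refine congrArg _ (Finset.prod_congr rfl fun x hx => ?_)
    rw [if_neg]
    rintro rfl
    exact (Finset.mem_sdiff.1 hx).2 ha
  · rw [Finset.prod_eq_zero (s := univ \ A) (i := a) (by simp [ha]) (by simp), mul_zero]

/-- A distribution `q` of maximal elements on `S` together with attention frequencies `φ` between
`q` and its upper cumulative sums is realised by a distribution over subsets of `S`. -/
theorem exists_consideration_distribution {α : Type*} [Fintype α] [DecidableEq α]
    {r : α → α → Prop} (hr : IsStrictTotalOrder α r) (S : Finset α) (q φ : α → ℝ)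
    (hq : ∀ a ∈ S, 0 ≤ q a) (hlow : ∀ a ∈ S, q a ≤ φ a)
    (hup : ∀ a ∈ S, φ a ≤ ∑ b ∈ S.filter (fun b => r b a ∨ b = a), q b) :
    ∃ m : Finset α → ℝ, (∀ T, 0 ≤ m T) ∧ (∀ T, ¬(T.Nonempty ∧ T ⊆ S) → m T = 0) ∧
      (∑ T, m T = ∑ a ∈ S, q a) ∧
      (∀ a ∈ S, ∑ T, (if IsMaxOf r a T then m T else 0) = q a) ∧
      (∀ a ∈ S, ∑ T, (if a ∈ T then m T else 0) = φ a) := by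
  set D : α → ℝ := fun a => ∑ b ∈ S, if r b a then q b else 0 with hD
  set p : α → ℝ := fun a => if a ∈ S then (φ a - q a) / D a else 0 with hp
  have hD0 : ∀ a, 0 ≤ D a := fun a => Finset.sum_nonneg fun b hb => by
    split_ifs
    exacts [hq b hb, le_rfl]
  have hupD : ∀ a ∈ S, φ a - q a ≤ D a := fun a ha => by
    have hsplit : ∑ b ∈ S.filter (fun b => r b a ∨ b = a), q b = D a + q a := by
      have hqa : q a = ∑ b ∈ S, if b = a then q b else 0 := by simp [ha]
      rw [hqa, hD, ← Finset.sum_add_distrib, Finset.sum_filter]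
      refine Finset.sum_congr rfl fun b _ => ?_
      by_cases hba : b = a
      · subst hba
        simp [irrefl_of r b]
      · simp [hba]
    linarith [hup a ha]
  have hp0 : ∀ a, 0 ≤ p a := fun a => by
    simp only [hp]
    split_ifs with ha
    · exact div_nonneg (sub_nonneg.2 (hlow a ha)) (hD0 a)
    · exact le_rfl
  have hp1 : ∀ a, p a ≤ 1 := fun a => by
    simp only [hp]
    split_ifs with ha
    · exact div_le_one_of_le₀ (hupD a ha) (hD0 a)
    · exact zero_le_one
  have hDp : ∀ a ∈ S, D a * p a = φ a - q a := fun a ha => by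
    simp only [hp, if_pos ha]
    rcases eq_or_ne (D a) 0 with h | h
    · have := hupD a ha
      have := hlow a ha
      rw [h, zero_mul]
      linarith
    · field_simp
  let f : α → Finset α → Finset α := fun b A => insert b (S.filter fun x => x ∈ A ∧ r b x)
  have hf : ∀ b A, IsMaxOf r b (f b A) := fun b A => by
    refine ⟨Finset.mem_insert_self _ _, fun x hx hne => ?_⟩
    rcases Finset.mem_insert.1 hx with h | h
    · exact absurd h hne
    · exact (Finset.mem_filter.1 h).2.2
  have hfS : ∀ b ∈ S, ∀ A, f b A ⊆ S := fun b hb A =>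
    Finset.insert_subset hb (Finset.filter_subset _ _)
  have hw : ∀ b ∈ S, ∀ A, 0 ≤ q b * bernoulliWeight p A := fun b hb A =>
    mul_nonneg (hq b hb) (bernoulliWeight_nonneg hp0 hp1 A)
  let m : Finset α → ℝ := fun T =>
    ∑ b ∈ S, ∑ A : Finset α, if f b A = T then q b * bernoulliWeight p A else 0
  have hpush : ∀ (P : Finset α → Prop) [DecidablePred P], ∑ T, (if P T then m T else 0) =
      ∑ b ∈ S, ∑ A : Finset α, if P (f b A) then q b * bernoulliWeight p A else 0 := fun P _ => by
    have h1 : ∀ T, (if P T then m T else 0) = ∑ b ∈ S, ∑ A : Finset α,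
        if f b A = T then (if P (f b A) then q b * bernoulliWeight p A else 0) else 0 := by
      intro T
      split_ifs with hP
      · refine Finset.sum_congr rfl fun b _ => Finset.sum_congr rfl fun A _ => ?_
        by_cases hfT : f b A = T
        · simp [hfT, hP]
        · simp [hfT]
      · refine (Finset.sum_eq_zero fun b _ => Finset.sum_eq_zero fun A _ => ?_).symm
        by_cases hfT : f b A = T
        · simp [hfT, hP]
        · simp [hfT]
    rw [Finset.sum_congr rfl fun T _ => h1 T, Finset.sum_comm]
    refine Finset.sum_congr rfl fun b _ => ?_
    rw [Finset.sum_comm]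
    exact Finset.sum_congr rfl fun A _ => by simp
  have hsum : ∀ b, ∑ A : Finset α, q b * bernoulliWeight p A = q b := fun b => by
    rw [← Finset.mul_sum, sum_bernoulliWeight, mul_one]
  refine ⟨m, fun T => ?_, fun T hT => ?_, ?_, fun a ha => ?_, fun a ha => ?_⟩
  · refine Finset.sum_nonneg fun b hb => Finset.sum_nonneg fun A _ => ?_
    split_ifs
    exacts [hw b hb A, le_rfl]
  · refine Finset.sum_eq_zero fun b hb => Finset.sum_eq_zero fun A _ => if_neg ?_
    rintro rfl
    exact hT ⟨⟨b, (hf b A).1⟩, hfS b hb A⟩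
  · have h := hpush fun _ => True
    simp only [if_true] at h
    rw [h]
    exact Finset.sum_congr rfl fun b _ => hsum b
  · rw [hpush, Finset.sum_eq_single_of_mem a ha]
    · simp only [hf, if_true]
      exact hsum a
    · refine fun b _ hba => Finset.sum_eq_zero fun A _ => if_neg fun h => ?_
      exact hba ((hf b A).unique hr h)
  · rw [hpush]
    have hmem : ∀ b A, a ∈ f b A ↔ b = a ∨ (a ∈ A ∧ r b a) := fun b A => by
      simp [f, ha, eq_comm]
    have hinner : ∀ b, ∑ A : Finset α,
        (if a ∈ f b A then q b * bernoulliWeight p A else 0) =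
        (if b = a then q b else 0) + (if r b a then q b else 0) * p a := fun b => by
      simp only [hmem]
      by_cases hba : b = a
      · subst hba
        simp [irrefl_of r b, hsum]
      · by_cases hrba : r b a
        · simp only [hba, hrba, and_true, false_or, if_true, if_false, zero_add]
          rw [← sum_bernoulliWeight_mem p a, Finset.mul_sum]
          simp only [mul_ite, mul_zero]
        · simp [hba, hrba]
    rw [Finset.sum_congr rfl fun b _ => hinner b, Finset.sum_add_distrib, ← Finset.sum_mul]
    have := hDp a ha
    simp only [hD] at this
    rw [this]
    simp [ha]

theorem SatisfiesAC.exists_represents {α : Type*} [Fintype α] [DecidableEq α]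
    {r : α → α → Prop} {π : α → Finset α → ℝ} (hr : IsStrictTotalOrder α r)
    (hπ : IsChoiceRule π) (hAC : SatisfiesAC π r) :
    ∃ μ : Finset α → Finset α → ℝ, AttentionOverload μ ∧ Represents r μ π := by
  have hne : ∀ S : Finset α, (univ.filter fun R => S ⊆ R).Nonempty := fun S => ⟨S, by simp⟩
  let φ : Finset α → α → ℝ := fun S a => (univ.filter fun R => S ⊆ R).sup' (hne S) (π a)
  have key : ∀ S : Finset α, ∃ m : Finset α → ℝ, S.Nonempty → (∀ T, 0 ≤ m T) ∧
      (∀ T, ¬(T.Nonempty ∧ T ⊆ S) → m T = 0) ∧ (∑ T, m T = ∑ a ∈ S, π a S) ∧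
      (∀ a ∈ S, ∑ T, (if IsMaxOf r a T then m T else 0) = π a S) ∧
      (∀ a ∈ S, ∑ T, (if a ∈ T then m T else 0) = φ S a) := fun S => by
    by_cases hS : S.Nonempty
    · obtain ⟨m, hm⟩ := exists_consideration_distribution hr S (fun a => π a S) (φ S) (hπ S hS).1
        (fun a _ => Finset.le_sup' (π a) (by simp))
        (fun a ha => Finset.sup'_le _ _ fun R hR => hAC a S R ha (Finset.mem_filter.1 hR).2)
      exact ⟨m, fun _ => hm⟩
    · exact ⟨0, fun h => absurd h hS⟩
  choose m hm using key
  have hsub : ∀ S : Finset α, S.Nonempty → ∀ (P : Finset α → Prop) [DecidablePred P],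
      ∑ T ∈ S.powerset, (if P T then m S T else 0) = ∑ T, (if P T then m S T else 0) := by
    intro S hS P _
    refine Finset.sum_subset (Finset.subset_univ _) fun T _ hT => ?_
    rw [(hm S hS).2.1 T fun h => hT (Finset.mem_powerset.2 h.2), ite_self]
  have hfreq : ∀ S : Finset α, ∀ a ∈ S, attFreq (fun T S => m S T) a S = φ S a := fun S a ha => by
    rw [attFreq, Finset.sum_filter, hsub S ⟨a, ha⟩, (hm S ⟨a, ha⟩).2.2.2.2 a ha]
  refine ⟨fun T S => m S T, fun a T S haT hTS => ?_, fun S hS => ⟨fun T _ _ => (hm S hS).1 T,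
    (hm S hS).2.1, ?_⟩, fun S hS a ha => ?_⟩
  · rw [hfreq S a (hTS haT), hfreq T a haT]
    refine Finset.sup'_mono _ (fun R hR => ?_) _
    simp only [Finset.mem_filter, Finset.mem_univ, true_and] at hR ⊢
    exact hTS.trans hR
  · rw [← (hπ S hS).2.2, ← (hm S hS).2.2.1]
    refine Finset.sum_subset (Finset.subset_univ _) fun T _ hT => (hm S hS).2.1 T fun h => hT ?_
    exact Finset.mem_filter.2 ⟨Finset.mem_powerset.2 h.2, h.1⟩
  · rw [hsub S hS, (hm S hS).2.2.2.1 a ha]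

/-- revealed preference is characterized by AC. -/
theorem revealed_preference_iff_AC {α : Type*} [Fintype α] [DecidableEq α]
    (π : α → Finset α → ℝ) (hπ : IsChoiceRule π) (hAOM : IsAOM π)
    (a b : α) (hne : a ≠ b) :
    (∀ (r : α → α → Prop) (μ : Finset α → Finset α → ℝ),
        IsStrictTotalOrder α r → AttentionOverload μ → Represents r μ π → r b a)
    ↔ (∀ r : α → α → Prop, IsStrictTotalOrder α r → SatisfiesAC π r → r b a) := by
  constructor
  · intro h r hr hAC
    obtain ⟨μ, hμ, hrep⟩ := hAC.exists_represents hr hπ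
    exact h r μ hr hμ hrep
  · intro h r μ hr hμ hrep
    exact h r hr (hrep.satisfiesAC hr hμ)
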